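/- arXiv:math/0203039 — 3 statements merged into one kernel-verified Lean document; each statement's English description precedes it below -/
import Mathlib

section
/- Let a be a nonzero real number. For s ∈ ℝ define φ^s : ℝ³ → ℝ³ on the set {(m,p,h) : m ≠ 0} by φ^s(m,p,h) = ( m, p - s·m, h + (cosh(a·(p - s·m)) - cosh(a·p))/(a²·m) ). Then φ^0 is the identity and for all real s, s' and all (m,p,h) with m ≠ 0, φ^s(φ^{s'}(m,p,h)) = φ^{s+s'}(m,p,h); i.e., (φ^s) is a one-parameter flow. -/
/-- The flow `φ^s(m,p,h) = (m, p - sm, h + (cosh(a(p-sm)) - cosh(ap))/(a²m))` of the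
vector field `K̂ = -m·∂_p - (sinh(ap)/a)·∂_h`. -/
noncomputable def galileiFlow (a s : ℝ) : ℝ × ℝ × ℝ → ℝ × ℝ × ℝ :=
  fun x => (x.1, x.2.1 - s * x.1,
    x.2.2 + (Real.cosh (a * (x.2.1 - s * x.1)) - Real.cosh (a * x.2.1)) / (a ^ 2 * x.1))

/-- On the set `{(m,p,h) : m ≠ 0}`, the maps `φ^s` form a one-parameter flow:
`φ^0 = id` and `φ^s ∘ φ^{s'} = φ^{s+s'}`. -/
theorem galileiFlow_is_flow (a : ℝ) (ha : a ≠ 0) :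
    (∀ m p h : ℝ, m ≠ 0 → galileiFlow a 0 (m, p, h) = (m, p, h)) ∧
    (∀ s s' : ℝ, ∀ m p h : ℝ, m ≠ 0 →
      galileiFlow a s (galileiFlow a s' (m, p, h)) = galileiFlow a (s + s') (m, p, h)) := by
  refine ⟨fun m p h _ => by simp [galileiFlow], fun s s' m p h _ => ?_⟩
  have hp : p - s' * m - s * m = p - (s + s') * m := by ring
  simp only [galileiFlow, hp, Prod.mk.injEq, true_and]
  ring
end

section
/- Let V = ℂ[x,t] be the polynomial algebra in two variables over ℂ, with partial derivative operators ∂ₓ and ∂ₜ. Fix a, α, β ∈ ℂ and define linear operators on V: Ĥφ = ∂ₜφ, S_aφ = ∑_{n≥0} (a^{2n}/(2n+1)!)·∂ₓ^{2n+1}φ (a finite sum on each polynomial, since ∂ₓ is locally nilpotent), and K̂φ = α·φ - β·x·φ - t·S_aφ. Then Ĥ∘K̂ - K̂∘Ĥ = -S_a as linear operators on V; since S_a = sinh(a·P̂)/a with P̂ = ∂ₓ, this is the q-deformed relation [H,K] = -sinh(aP)/a. -/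
open MvPolynomial

/-- `∂ₓ` on `ℂ[x,t]` (variable `0` is `x`, variable `1` is `t`). -/
noncomputable def galDx (φ : MvPolynomial (Fin 2) ℂ) : MvPolynomial (Fin 2) ℂ :=
  pderiv (0 : Fin 2) φ

/-- `∂ₜ` on `ℂ[x,t]`. -/
noncomputable def galDt (φ : MvPolynomial (Fin 2) ℂ) : MvPolynomial (Fin 2) ℂ :=
  pderiv (1 : Fin 2) φ

/-- The locally finite series `S_a = sinh(a·∂ₓ)/a = ∑ₙ (a^{2n}/(2n+1)!)·∂ₓ^{2n+1}`;
a finite sum on each polynomial since `∂ₓ` is locally nilpotent. -/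
noncomputable def galSa (a : ℂ) (φ : MvPolynomial (Fin 2) ℂ) : MvPolynomial (Fin 2) ℂ :=
  ∑ᶠ n : ℕ, (a ^ (2 * n) / ((2 * n + 1).factorial : ℂ)) • galDx^[2 * n + 1] φ

/-- The boost operator `K̂φ = α·φ - β·x·φ - t·S_aφ` of the local representation. -/
noncomputable def galK (a α β : ℂ) (φ : MvPolynomial (Fin 2) ℂ) : MvPolynomial (Fin 2) ℂ :=
  α • φ - β • (X 0 * φ) - X 1 * galSa a φ

section PDeriv

variable {σ R : Type*} [CommRing R]

theorem MvPolynomial.pderiv_comm_pderiv (i j : σ) (p : MvPolynomial σ R) :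
    pderiv i (pderiv j p) = pderiv j (pderiv i p) := by
  classical
  let D (k : σ) : Derivation R (MvPolynomial σ R) (MvPolynomial σ R) := pderiv k
  have h : ⁅D i, D j⁆ = 0 := by
    refine derivation_ext fun k => ?_
    simp [D, Derivation.commutator_apply, pderiv_X, Pi.single_apply, apply_ite]
  simpa [D, Derivation.commutator_apply, sub_eq_zero] using congrArg (fun d => d p) h

theorem MvPolynomial.iterate_pderiv_monomial_eq_zero (i : σ) (n : ℕ) (s : σ →₀ ℕ) (r : R)
    (h : s i < n) : (pderiv i)^[n] (monomial s r) = 0 := by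
  induction n generalizing s r with
  | zero => simp at h
  | succ n ih =>
    rw [Function.iterate_succ_apply, pderiv_monomial]
    rcases Nat.eq_zero_or_pos (s i) with h0 | h0
    · simp [h0, iterate_map_zero]
    · refine ih _ _ ?_
      simp only [Finsupp.coe_tsub, Pi.sub_apply, Finsupp.single_eq_same]
      omega

/-- Each partial derivative is locally nilpotent on polynomials. -/
theorem MvPolynomial.exists_iterate_pderiv_eq_zero (i : σ) (p : MvPolynomial σ R) :
    ∃ N, ∀ n, N ≤ n → (pderiv i)^[n] p = 0 := by
  induction p using MvPolynomial.induction_on' with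
  | monomial s r =>
    exact ⟨s i + 1, fun n hn => iterate_pderiv_monomial_eq_zero i n s r hn⟩
  | add p q hp hq =>
    obtain ⟨M, hM⟩ := hp
    obtain ⟨N, hN⟩ := hq
    refine ⟨max M N, fun n hn => ?_⟩
    rw [iterate_map_add, hM n (le_of_max_le_left hn), hN n (le_of_max_le_right hn), add_zero]

end PDeriv

theorem galSa_hasFiniteSupport (a : ℂ) (φ : MvPolynomial (Fin 2) ℂ) :
    (Function.support fun n : ℕ =>
      (a ^ (2 * n) / ((2 * n + 1).factorial : ℂ)) • galDx^[2 * n + 1] φ).Finite := by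
  obtain ⟨N, hN⟩ := exists_iterate_pderiv_eq_zero (0 : Fin 2) φ
  refine (Set.finite_lt_nat N).subset fun n hn => ?_
  by_contra hlt
  refine hn ?_
  have h : galDx^[2 * n + 1] φ = 0 := hN _ (by simp only [Set.mem_ofPred_eq] at hlt; omega)
  simp only [h, smul_zero]

theorem galDt_galSa (a : ℂ) (φ : MvPolynomial (Fin 2) ℂ) :
    galDt (galSa a φ) = galSa a (galDt φ) := by
  have hcomm : Function.Commute galDt galDx := fun p => pderiv_comm_pderiv 1 0 p
  refine ((pderiv (1 : Fin 2)).toLinearMap.toAddMonoidHom.map_finsum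
    (galSa_hasFiniteSupport a φ)).trans (finsum_congr fun n => ?_)
  refine ((pderiv (1 : Fin 2)).map_smul _ _).trans ?_
  exact congrArg _ ((hcomm.iterate_right (2 * n + 1)) φ)

/-- The operators `Ĥ = ∂ₜ` and `K̂ = α - βx - t·sinh(a∂ₓ)/a` of the local
representation of `U_q(ḡ(1,1))` satisfy the q-deformed relation `[Ĥ, K̂] = -S_a`,
i.e. `[H,K] = -sinh(aP)/a` with `P̂ = ∂ₓ`, on `ℂ[x,t]`. -/
theorem galilei_local_rep_HK (a α β : ℂ) :
    ∀ φ : MvPolynomial (Fin 2) ℂ,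
      galDt (galK a α β φ) - galK a α β (galDt φ) = -galSa a φ := by
  intro φ
  have h := galDt_galSa a φ
  unfold galK
  rw [← h]
  simp only [galDt, map_sub, Derivation.map_smul, Derivation.leibniz, pderiv_X_self,
    pderiv_X_of_ne (show (0 : Fin 2) ≠ 1 by decide), smul_eq_mul, mul_zero, mul_one, add_zero]
  abel
end

section
/- Let V = ℂ[x,t] be the polynomial algebra in two variables over ℂ, with partial derivative operators ∂ₓ and ∂ₜ. Fix a, α, β ∈ ℂ and define linear operators on V: S_aφ = ∑_{n≥0} (a^{2n}/(2n+1)!)·∂ₓ^{2n+1}φ, K̂φ = α·φ - β·x·φ - t·S_aφ, and the q-Casimir operator Ĉφ = β·∂ₜφ - ∑_{n≥1} (a^{2n-2}/(2n)!)·∂ₓ^{2n}φ (i.e., Ĉ = β∂ₜ + (1 - cosh(a∂ₓ))/a², a finite sum on each polynomial). Then Ĉ∘K̂ = K̂∘Ĉ, and Ĉ also commutes with ∂ₓ, ∂ₜ and with multiplication by β. -/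
open MvPolynomial

/-- The q-Casimir operator `Ĉ = β·∂ₜ + (1 - cosh(a∂ₓ))/a²`, i.e.
`Ĉφ = β·∂ₜφ - ∑_{n≥1} (a^{2n-2}/(2n)!)·∂ₓ^{2n}φ`; a finite sum on each polynomial. -/
noncomputable def galC (a β : ℂ) (φ : MvPolynomial (Fin 2) ℂ) : MvPolynomial (Fin 2) ℂ :=
  β • galDt φ -
    ∑ᶠ n : ℕ, (a ^ (2 * (n + 1) - 2) / ((2 * (n + 1)).factorial : ℂ)) • galDx^[2 * (n + 1)] φ

/-- `∂ₓ` as a linear endomorphism. -/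
noncomputable abbrev galDxEnd : Module.End ℂ (MvPolynomial (Fin 2) ℂ) :=
  (pderiv (0 : Fin 2) : Derivation ℂ (MvPolynomial (Fin 2) ℂ) _).toLinearMap

/-- `∂ₜ` as a linear endomorphism. -/
noncomputable abbrev galDtEnd : Module.End ℂ (MvPolynomial (Fin 2) ℂ) :=
  (pderiv (1 : Fin 2) : Derivation ℂ (MvPolynomial (Fin 2) ℂ) _).toLinearMap

theorem galDx_iterate (n : ℕ) (φ : MvPolynomial (Fin 2) ℂ) :
    galDx^[n] φ = (galDxEnd ^ n) φ := by
  rw [Module.End.pow_apply]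
  rfl

theorem galDxEnd_X_zero_mul (φ : MvPolynomial (Fin 2) ℂ) :
    galDxEnd (X 0 * φ) = X 0 * galDxEnd φ + φ := by
  simp [Derivation.leibniz]

theorem galDxEnd_X_one_mul (φ : MvPolynomial (Fin 2) ℂ) :
    galDxEnd (X 1 * φ) = X 1 * galDxEnd φ := by
  simp [Derivation.leibniz]

theorem galDtEnd_X_zero_mul (φ : MvPolynomial (Fin 2) ℂ) :
    galDtEnd (X 0 * φ) = X 0 * galDtEnd φ := by
  simp [Derivation.leibniz]

theorem galDtEnd_X_one_mul (φ : MvPolynomial (Fin 2) ℂ) :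
    galDtEnd (X 1 * φ) = X 1 * galDtEnd φ + φ := by
  simp [Derivation.leibniz]

theorem galDxEnd_pow_X_one_mul (n : ℕ) (φ : MvPolynomial (Fin 2) ℂ) :
    (galDxEnd ^ n) (X 1 * φ) = X 1 * (galDxEnd ^ n) φ := by
  induction n with
  | zero => simp
  | succ n ih => rw [pow_succ', Module.End.mul_apply, ih, galDxEnd_X_one_mul, Module.End.mul_apply]

theorem galDxEnd_pow_succ_X_zero_mul (n : ℕ) (φ : MvPolynomial (Fin 2) ℂ) :
    (galDxEnd ^ (n + 1)) (X 0 * φ) =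
      X 0 * (galDxEnd ^ (n + 1)) φ + ((n : ℂ) + 1) • (galDxEnd ^ n) φ := by
  induction n with
  | zero => simp
  | succ n ih =>
    rw [pow_succ', Module.End.mul_apply, ih, map_add, map_smul, galDxEnd_X_zero_mul,
      ← Module.End.mul_apply, ← pow_succ', ← Module.End.mul_apply, ← pow_succ']
    push_cast
    module

/-- `∂ₓ` is locally nilpotent. -/
theorem eventually_galDxEnd_pow_eq_zero (φ : MvPolynomial (Fin 2) ℂ) :
    ∀ᶠ n : ℕ in Filter.atTop, (galDxEnd ^ n) φ = 0 := by
  induction φ using MvPolynomial.induction_on with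
  | C c =>
    filter_upwards [Filter.eventually_ge_atTop 1] with n hn
    obtain ⟨m, rfl⟩ := Nat.exists_eq_add_of_le' hn
    rw [pow_succ, Module.End.mul_apply]
    simp
  | add p q hp hq =>
    filter_upwards [hp, hq] with n h₁ h₂
    rw [map_add, h₁, h₂, add_zero]
  | mul_X p i hp =>
    rw [mul_comm]
    fin_cases i
    · obtain ⟨M, hM⟩ := Filter.eventually_atTop.1 hp
      filter_upwards [Filter.eventually_ge_atTop (M + 1)] with n hn
      obtain ⟨m, rfl⟩ := Nat.exists_eq_add_of_le' (show 1 ≤ n by omega)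
      exact (galDxEnd_pow_succ_X_zero_mul m p).trans
        (by rw [hM _ (by omega), hM _ (by omega), mul_zero, smul_zero, add_zero])
    · filter_upwards [hp] with n hn
      exact (galDxEnd_pow_X_one_mul n p).trans (by rw [hn, mul_zero])

theorem eventually_finsum_galDx_eq (c : ℕ → ℂ) (e : ℕ → ℕ) (he : ∀ n, n ≤ e n)
    (φ : MvPolynomial (Fin 2) ℂ) :
    ∀ᶠ N : ℕ in Filter.atTop, ∑ᶠ n : ℕ, c n • galDx^[e n] φ =
      (∑ n ∈ Finset.range N, c n • galDxEnd ^ e n) φ := by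
  obtain ⟨M, hM⟩ := Filter.eventually_atTop.1 (eventually_galDxEnd_pow_eq_zero φ)
  filter_upwards [Filter.eventually_ge_atTop M] with N hN
  rw [finsum_eq_sum_of_support_subset (s := Finset.range N)]
  · simp only [LinearMap.sum_apply, LinearMap.smul_apply, galDx_iterate]
  · intro n hn
    by_contra h
    simp only [Finset.coe_range, Set.mem_Iio, not_lt] at h
    exact hn (by simp only [galDx_iterate, hM _ (hN.trans (h.trans (he n))), smul_zero])

/-- The truncation of `S_a` to its first `N` terms. -/
noncomputable def galSaTrunc (a : ℂ) (N : ℕ) : Module.End ℂ (MvPolynomial (Fin 2) ℂ) :=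
  ∑ n ∈ Finset.range N, (a ^ (2 * n) / ((2 * n + 1).factorial : ℂ)) • galDxEnd ^ (2 * n + 1)

/-- The truncation of `(cosh(a∂ₓ) - 1)/a²` to its first `N` terms. -/
noncomputable def galCoshTrunc (a : ℂ) (N : ℕ) : Module.End ℂ (MvPolynomial (Fin 2) ℂ) :=
  ∑ n ∈ Finset.range N,
    (a ^ (2 * (n + 1) - 2) / ((2 * (n + 1)).factorial : ℂ)) • galDxEnd ^ (2 * (n + 1))

theorem eventually_galK_eq (a α β : ℂ) (φ : MvPolynomial (Fin 2) ℂ) :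
    ∀ᶠ N : ℕ in Filter.atTop, galK a α β φ = α • φ - β • (X 0 * φ) - X 1 * galSaTrunc a N φ := by
  filter_upwards [eventually_finsum_galDx_eq
    (fun n => a ^ (2 * n) / ((2 * n + 1).factorial : ℂ)) (fun n => 2 * n + 1)
    (fun n => by omega) φ] with N hN
  rw [galK, galSa, hN, galSaTrunc]

theorem eventually_galC_eq (a β : ℂ) (φ : MvPolynomial (Fin 2) ℂ) :
    ∀ᶠ N : ℕ in Filter.atTop, galC a β φ = β • galDtEnd φ - galCoshTrunc a N φ := by
  filter_upwards [eventually_finsum_galDx_eq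
    (fun n => a ^ (2 * (n + 1) - 2) / ((2 * (n + 1)).factorial : ℂ)) (fun n => 2 * (n + 1))
    (fun n => by omega) φ] with N hN
  rw [galC, hN, galCoshTrunc]
  rfl

theorem galCoshTrunc_X_one_mul (a : ℂ) (N : ℕ) (φ : MvPolynomial (Fin 2) ℂ) :
    galCoshTrunc a N (X 1 * φ) = X 1 * galCoshTrunc a N φ := by
  simp only [galCoshTrunc, LinearMap.sum_apply, LinearMap.smul_apply, galDxEnd_pow_X_one_mul,
    Finset.mul_sum, mul_smul_comm]

theorem galCoshTrunc_X_zero_mul (a : ℂ) (N : ℕ) (φ : MvPolynomial (Fin 2) ℂ) :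
    galCoshTrunc a N (X 0 * φ) = X 0 * galCoshTrunc a N φ + galSaTrunc a N φ := by
  simp only [galCoshTrunc, galSaTrunc, LinearMap.sum_apply, LinearMap.smul_apply,
    Finset.mul_sum, mul_smul_comm, ← Finset.sum_add_distrib]
  refine Finset.sum_congr rfl fun n _ => ?_
  rw [show 2 * (n + 1) - 2 = 2 * n by omega, show 2 * (n + 1) = 2 * n + 1 + 1 by ring,
    galDxEnd_pow_succ_X_zero_mul, smul_add, smul_smul, Nat.factorial_succ (2 * n + 1)]
  congr 2
  have h : ((2 * n + 1 : ℕ) : ℂ) + 1 ≠ 0 := Nat.cast_add_one_ne_zero _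
  have h' : ((2 * n + 1).factorial : ℂ) ≠ 0 := Nat.cast_ne_zero.2 (Nat.factorial_ne_zero _)
  rw [Nat.cast_mul, Nat.cast_succ (2 * n + 1)]
  field_simp

theorem commute_galDtEnd_galDxEnd : Commute galDtEnd galDxEnd := by
  refine LinearMap.ext fun φ => sub_eq_zero.1 ?_
  have h : ⁅pderiv (R := ℂ) (1 : Fin 2), pderiv (R := ℂ) (0 : Fin 2)⁆ = 0 := by
    refine derivation_ext fun i => ?_
    rw [Derivation.commutator_apply]
    fin_cases i <;> simp [pderiv_X]
  have hφ := DFunLike.congr_fun h φ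
  rw [Derivation.commutator_apply] at hφ
  exact hφ

theorem commute_galSaTrunc {A : Module.End ℂ (MvPolynomial (Fin 2) ℂ)}
    (hA : Commute A galDxEnd) (a : ℂ) (N : ℕ) : Commute A (galSaTrunc a N) :=
  Commute.sum_right _ _ _ fun _ _ => (hA.pow_right _).smul_right _

theorem commute_galCoshTrunc {A : Module.End ℂ (MvPolynomial (Fin 2) ℂ)}
    (hA : Commute A galDxEnd) (a : ℂ) (N : ℕ) : Commute A (galCoshTrunc a N) :=
  Commute.sum_right _ _ _ fun _ _ => (hA.pow_right _).smul_right _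

theorem galC_comm_of_commute {A : Module.End ℂ (MvPolynomial (Fin 2) ℂ)}
    (hx : Commute A galDxEnd) (ht : Commute A galDtEnd) (a β : ℂ) (φ : MvPolynomial (Fin 2) ℂ) :
    galC a β (A φ) = A (galC a β φ) := by
  obtain ⟨N, h₁, h₂⟩ := ((eventually_galC_eq a β (A φ)).and (eventually_galC_eq a β φ)).exists
  have hP := LinearMap.congr_fun (commute_galCoshTrunc hx a N).eq φ
  have hT := LinearMap.congr_fun ht.eq φ
  simp only [Module.End.mul_apply] at hP hT
  rw [h₁, h₂, map_sub, map_smul, hP, hT]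

theorem galC_galK (a α β : ℂ) (φ : MvPolynomial (Fin 2) ℂ) :
    galC a β (galK a α β φ) = galK a α β (galC a β φ) := by
  obtain ⟨N, ⟨h₁, h₂⟩, h₃, h₄⟩ :=
    (((eventually_galC_eq a β (galK a α β φ)).and (eventually_galK_eq a α β φ)).and
      ((eventually_galK_eq a α β (galC a β φ)).and (eventually_galC_eq a β φ))).exists
  have hS := LinearMap.congr_fun (commute_galSaTrunc commute_galDtEnd_galDxEnd a N).eq φ
  have hP := LinearMap.congr_fun (commute_galSaTrunc
    (commute_galCoshTrunc (Commute.refl galDxEnd) a N).symm a N).eq φ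
  simp only [Module.End.mul_apply] at hS hP
  rw [h₁, h₂, h₃, h₄]
  simp only [map_sub, map_smul, galDtEnd_X_zero_mul, galDtEnd_X_one_mul, galCoshTrunc_X_zero_mul,
    galCoshTrunc_X_one_mul, hS, hP, mul_sub, mul_smul_comm]
  module

/-- The q-Casimir operator `Ĉ = β∂ₜ + (1 - cosh(a∂ₓ))/a²` commutes with the boost
operator `K̂` of the local representation of `U_q(ḡ(1,1))`, and also with `∂ₓ`, `∂ₜ`
and with multiplication by `β`. -/
theorem galilei_casimir_commutes (a α β : ℂ) :
    (∀ φ : MvPolynomial (Fin 2) ℂ, galC a β (galK a α β φ) = galK a α β (galC a β φ)) ∧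
    (∀ φ : MvPolynomial (Fin 2) ℂ, galC a β (galDx φ) = galDx (galC a β φ)) ∧
    (∀ φ : MvPolynomial (Fin 2) ℂ, galC a β (galDt φ) = galDt (galC a β φ)) ∧
    (∀ φ : MvPolynomial (Fin 2) ℂ, galC a β (β • φ) = β • galC a β φ) := by
  exact ⟨galC_galK a α β,
    galC_comm_of_commute (Commute.refl galDxEnd) commute_galDtEnd_galDxEnd.symm a β,
    galC_comm_of_commute commute_galDtEnd_galDxEnd (Commute.refl galDtEnd) a β,
    galC_comm_of_commute (A := β • 1) ((Commute.one_left _).smul_left β)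
      ((Commute.one_left _).smul_left β) a β⟩
end
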